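/- arXiv:2206.15225 — 5 statements merged into one kernel-verified Lean document; each statement's English description precedes it below -/
import Mathlib

section
/- Let F = {C_1, ..., C_m} be a hitting CNF formula whose variables are exactly an n-element set of variables. Then the number of total assignments of those n variables that satisfy F equals 2^n · (1 - Σ_{i=1}^m 2^{-|C_i|}). -/
/-- A literal: a variable (natural number) with a polarity. -/
abbrev Lit : Type := ℕ × Bool

/-- Negation of a literal. -/
def Lit.neg (ℓ : Lit) : Lit := (ℓ.1, !ℓ.2)

/-- A clause: a finite set of literals. -/
abbrev Clause : Type := Finset Lit

/-- A clause is non-tautological: it contains no literal together with its negation. -/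
def Clause.NonTaut (C : Clause) : Prop := ∀ ℓ ∈ C, Lit.neg ℓ ∉ C

/-- A CNF formula: a finite set of clauses. -/
abbrev CNF : Type := Finset Clause

/-- A CNF formula is well-formed if all of its clauses are non-tautological. -/
def CNF.WellFormed (F : CNF) : Prop := ∀ C ∈ F, C.NonTaut

/-- A (total) assignment `τ` satisfies a literal. -/
def SatLit (τ : ℕ → Bool) (ℓ : Lit) : Prop := τ ℓ.1 = ℓ.2

/-- An assignment satisfies a clause if it satisfies some literal of it. -/
def SatClause (τ : ℕ → Bool) (C : Clause) : Prop := ∃ ℓ ∈ C, SatLit τ ℓ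

/-- An assignment satisfies a CNF formula if it satisfies all of its clauses. -/
def SatCNF (τ : ℕ → Bool) (F : CNF) : Prop := ∀ C ∈ F, SatClause τ C

/-- A CNF formula is unsatisfiable if no assignment satisfies it. -/
def Unsat (F : CNF) : Prop := ¬ ∃ τ : ℕ → Bool, SatCNF τ F

/-- `F` entails `G`: every model of `F` is a model of `G`. -/
def Entails (F G : CNF) : Prop := ∀ τ : ℕ → Bool, SatCNF τ F → SatCNF τ G

/-- Logical equivalence of CNF formulas. -/
def Equivalent (F G : CNF) : Prop := Entails F G ∧ Entails G F

/-- Two clauses clash: one contains a literal whose negation is in the other. -/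
def Clash (C D : Clause) : Prop := ∃ ℓ ∈ C, Lit.neg ℓ ∈ D

/-- A formula is hitting if every pair of distinct clauses clashes. -/
def Hitting (F : CNF) : Prop := ∀ C ∈ F, ∀ D ∈ F, C ≠ D → Clash C D

/-- The set of variables occurring in a CNF formula. -/
def cnfVars (F : CNF) : Finset ℕ := F.sup fun C => C.image Prod.fst

/-- The assignment that is `true` exactly on the finite set `S`. -/
def indicatorAssignment : Finset ℕ ↪ (ℕ → Bool) where
  toFun S v := decide (v ∈ S)
  inj' S T h := by
    ext v
    simpa using congrFun h v

@[simp]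
theorem indicatorAssignment_apply (S : Finset ℕ) (v : ℕ) :
    indicatorAssignment S v = decide (v ∈ S) := rfl

/-- The variables occurring in `C` with polarity `b`. -/
def Clause.varsOf (C : Clause) (b : Bool) : Finset ℕ := (C.filter fun ℓ => ℓ.2 = b).image Prod.fst

theorem Clause.mem_varsOf {C : Clause} {b : Bool} {v : ℕ} : v ∈ C.varsOf b ↔ (v, b) ∈ C := by
  simp [Clause.varsOf]

theorem Clause.card_varsOf (C : Clause) (b : Bool) :
    (C.varsOf b).card = (C.filter fun ℓ => ℓ.2 = b).card := by
  refine Finset.card_image_of_injOn fun x hx y hy hxy => ?_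
  simp only [Finset.coe_filter, Set.mem_ofPred_eq] at hx hy
  exact Prod.ext hxy (hx.2.trans hy.2.symm)

theorem Clause.card_varsOf_true_add_false (C : Clause) :
    (C.varsOf true).card + (C.varsOf false).card = C.card := by
  simpa [Clause.card_varsOf] using
    Finset.card_filter_add_card_filter_not (s := C) (fun ℓ => ℓ.2 = true)

/-- The assignments, as subsets of `V`, that falsify `C` form an interval. -/
def falsifiers (V : Finset ℕ) (C : Clause) : Finset (Finset ℕ) :=
  Finset.Icc (C.varsOf false) (V \ C.varsOf true)

theorem mem_falsifiers {V S : Finset ℕ} {C : Clause} :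
    S ∈ falsifiers V C ↔ S ⊆ V ∧ ¬ SatClause (indicatorAssignment S) C := by
  simp only [falsifiers, Finset.mem_Icc, Finset.subset_iff, Finset.mem_sdiff, Clause.mem_varsOf,
    SatClause, SatLit, indicatorAssignment_apply, Prod.exists, Bool.exists_bool]
  grind

theorem card_falsifiers {V : Finset ℕ} {C : Clause} (hC : C.NonTaut)
    (hV : C.image Prod.fst ⊆ V) :
    ((falsifiers V C).card : ℚ) = 2 ^ V.card * 2 ^ (-(C.card : ℤ)) := by
  have mem_V {b v} (h : v ∈ C.varsOf b) : v ∈ V :=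
    hV (Finset.mem_image_of_mem Prod.fst (Clause.mem_varsOf.1 h))
  have hPV : C.varsOf true ⊆ V := fun _ => mem_V
  have hsub : C.varsOf false ⊆ V \ C.varsOf true := fun v hv =>
    Finset.mem_sdiff.2 ⟨mem_V hv, fun h =>
      hC _ (Clause.mem_varsOf.1 h) (Clause.mem_varsOf.1 hv)⟩
  have hcard : (V \ C.varsOf true).card - (C.varsOf false).card + C.card = V.card := by
    have h₁ := Finset.card_le_card hsub
    have h₂ := Finset.card_sdiff_add_card_eq_card hPV
    have h₃ := C.card_varsOf_true_add_false
    omega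
  rw [falsifiers, Finset.card_Icc_finset hsub, ← hcard, pow_add, zpow_neg, zpow_natCast]
  push_cast
  field_simp

theorem disjoint_falsifiers {V : Finset ℕ} {C D : Clause} (h : Clash C D) :
    Disjoint (falsifiers V C) (falsifiers V D) := by
  refine Finset.disjoint_left.2 fun S hC hD => ?_
  obtain ⟨ℓ, hℓC, hℓD⟩ := h
  refine (mem_falsifiers.1 hC).2 ⟨ℓ, hℓC, ?_⟩
  by_contra hne
  exact (mem_falsifiers.1 hD).2 ⟨_, hℓD, Bool.eq_not_of_ne hne⟩

theorem card_models {F : CNF} {V : Finset ℕ} :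
    Nat.card {τ : ℕ → Bool // (∀ v ∉ V, τ v = false) ∧ SatCNF τ F} =
      (V.powerset \ F.biUnion (falsifiers V)).card := by
  rw [← Finset.card_map indicatorAssignment]
  refine Nat.subtype_card _ fun τ => ?_
  simp only [Finset.mem_map, Finset.mem_sdiff, Finset.mem_powerset, Finset.mem_biUnion,
    mem_falsifiers, not_exists, not_and, not_not]
  constructor
  · rintro ⟨S, ⟨hS, hsat⟩, rfl⟩
    exact ⟨fun v hv => decide_eq_false fun h => hv (hS h), fun C hC => hsat C hC hS⟩
  · rintro ⟨hoff, hsat⟩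
    have hτ : indicatorAssignment (V.filter fun v => τ v = true) = τ := by
      ext v
      by_cases hv : v ∈ V <;> simp [hv, hoff]
    exact ⟨_, ⟨Finset.filter_subset _ _, fun C hC _ => hτ.symm ▸ hsat C hC⟩, hτ⟩

/-- Iwama's counting theorem: if `F` is a hitting formula whose
variables are exactly the `n`-element set `V`, then the number of total assignments
of the variables of `V` satisfying `F` is `2^n * (1 - ∑_{C ∈ F} 2^{-|C|})`.
(Assignments of `V` are encoded as functions `ℕ → Bool` that are `false` off `V`.) -/
theorem hitting_model_count (F : CNF) (V : Finset ℕ) (n : ℕ)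
    (hwf : F.WellFormed) (hhit : Hitting F)
    (hvars : cnfVars F = V) (hn : V.card = n) :
    (Nat.card {τ : ℕ → Bool // (∀ v ∉ V, τ v = false) ∧ SatCNF τ F} : ℚ) =
      2 ^ n * (1 - ∑ C ∈ F, (2 : ℚ) ^ (-(C.card : ℤ))) := by
  subst hvars hn
  have hsub : F.biUnion (falsifiers (cnfVars F)) ⊆ (cnfVars F).powerset :=
    Finset.biUnion_subset.2 fun C _ S hS => Finset.mem_powerset.2 (mem_falsifiers.1 hS).1
  rw [card_models, Finset.cast_card_sdiff hsub, Finset.card_powerset,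
    Finset.card_biUnion fun C hC D hD hne => disjoint_falsifiers (hhit C hC D hD hne),
    mul_sub, mul_one, Finset.mul_sum, Nat.cast_sum]
  push_cast
  congr 1
  exact Finset.sum_congr rfl fun C hC =>
    card_falsifiers (hwf C hC) (Finset.le_sup (f := fun C : Clause => C.image Prod.fst) hC)
end

section
/- Every unsatisfiable hitting CNF formula is saturated minimally unsatisfiable: it is unsatisfiable, removing any clause yields a satisfiable formula, and adding any literal (on any variable, including a fresh one) to any clause yields a satisfiable formula. -/
/-- A non-tautological clause can be falsified by an assignment with a prescribed value on all
variables outside the clause. -/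
theorem Clause.NonTaut.exists_falsifying {C : Clause} (hC : C.NonTaut) (b : Bool) :
    ∃ τ : ℕ → Bool, (∀ ℓ ∈ C, SatLit τ ℓ.neg) ∧
      ∀ ℓ : Lit, ℓ ∉ C → ℓ.neg ∉ C → τ ℓ.1 = b := by
  refine ⟨fun v => if (v, false) ∈ C then true else if (v, true) ∈ C then false else b, ?_, ?_⟩
  · rintro ⟨v, _ | _⟩ h
    · simp [SatLit, Lit.neg, h]
    · have h' : (v, false) ∉ C := hC _ h
      simp [SatLit, Lit.neg, h, h']
  · rintro ⟨v, _ | _⟩ h h' <;> simp_all [Lit.neg]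

/-- In a hitting formula, an assignment falsifying one clause satisfies all the others. -/
theorem Hitting.satCNF_erase {F : CNF} (hF : Hitting F) {C : Clause} (hC : C ∈ F)
    {τ : ℕ → Bool} (hτ : ∀ ℓ ∈ C, SatLit τ ℓ.neg) : SatCNF τ (F.erase C) := by
  intro D hD
  obtain ⟨hne, hDF⟩ := Finset.mem_erase.mp hD
  obtain ⟨ℓ, hℓ, hneg⟩ := hF C hC D hDF hne.symm
  exact ⟨ℓ.neg, hneg, hτ ℓ hℓ⟩

/-- every unsatisfiable hitting formula is saturated minimally
unsatisfiable: it is unsatisfiable, removing any clause yields a satisfiable formula,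
and adding any literal `ℓ` (with `ℓ ∉ C` and `¬ℓ ∉ C`) to any clause `C ∈ F`
yields a satisfiable formula. -/
theorem hitting_saturated_mu (F : CNF) (hwf : F.WellFormed) (hhit : Hitting F)
    (hunsat : Unsat F) :
    Unsat F ∧
      (∀ C ∈ F, ∃ τ : ℕ → Bool, SatCNF τ (F.erase C)) ∧
      (∀ C ∈ F, ∀ ℓ : Lit, ℓ ∉ C → Lit.neg ℓ ∉ C →
        ∃ τ : ℕ → Bool, SatCNF τ (insert (insert ℓ C) (F.erase C))) := by
  refine ⟨hunsat, fun C hC => ?_, fun C hC ℓ hℓ hneg => ?_⟩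
  · obtain ⟨τ, hτ, -⟩ := (hwf C hC).exists_falsifying true
    exact ⟨τ, hhit.satCNF_erase hC hτ⟩
  · obtain ⟨τ, hτ, hb⟩ := (hwf C hC).exists_falsifying ℓ.2
    refine ⟨τ, fun D hD => ?_⟩
    rcases Finset.mem_insert.mp hD with rfl | hD
    · exact ⟨ℓ, Finset.mem_insert_self ℓ C, hb ℓ hℓ hneg⟩
    · exact hhit.satCNF_erase hC hτ D hD
end

section
/- Let F ⊆ G be CNF formulas. Then F is a factor of G (i.e., F is logically equivalent to a single clause) if and only if there is a clause C such that C ⊆ D for every D ∈ F and the formula {D \ C : D ∈ F} is unsatisfiable. -/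
/-- Any assignment can be changed to falsify a non-tautological clause `C` while keeping all
true literals outside `C` true. -/
theorem Clause.NonTaut.exists_falsify {C : Clause} (hC : C.NonTaut) (τ : ℕ → Bool) :
    ∃ τ' : ℕ → Bool, ¬ SatClause τ' C ∧ ∀ ℓ ∉ C, SatLit τ ℓ → SatLit τ' ℓ := by
  refine ⟨fun v => if (v, τ v) ∈ C then !τ v else τ v, ?_, ?_⟩
  · rintro ⟨⟨v, b⟩, hb, h⟩
    simp only [SatLit] at h
    split_ifs at h with hv
    · exact hC _ hv (by simpa [Lit.neg, h] using hb)
    · exact hv (h ▸ hb)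
  · rintro ⟨v, b⟩ hb h
    simp only [SatLit] at h ⊢
    rw [h, if_neg hb]

/-- for `F ⊆ G`, `F` is a factor of `G` (logically equivalent to a
single clause) iff there is a clause `C` with `C ⊆ D` for every `D ∈ F` such that
`{D \ C : D ∈ F}` is unsatisfiable. -/
theorem factor_characterisation (G F : CNF) (hwf : G.WellFormed) (hFG : F ⊆ G) :
    (∃ C : Clause, C.NonTaut ∧ Equivalent F {C}) ↔
      (∃ C : Clause, C.NonTaut ∧ (∀ D ∈ F, C ⊆ D) ∧
        Unsat (F.image fun D => D \ C)) := by
  constructor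
  · rintro ⟨C, hC, hFC, hCF⟩
    refine ⟨C, hC, fun D hD ℓ hℓ => ?_, ?_⟩
    · by_contra hℓD
      obtain ⟨τ, hτD, hτ⟩ := (hwf D (hFG hD)).exists_falsify fun _ => ℓ.2
      exact hτD (hCF τ (by simpa [SatCNF] using ⟨ℓ, hℓ, hτ ℓ hℓD rfl⟩) D hD)
    · rintro ⟨τ, hτ⟩
      obtain ⟨τ', hτC, hτ'⟩ := hC.exists_falsify τ
      refine hτC (hFC τ' (fun D hD => ?_) C (Finset.mem_singleton_self C))
      obtain ⟨ℓ, hℓ, h⟩ := hτ _ (Finset.mem_image_of_mem _ hD)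
      rw [Finset.mem_sdiff] at hℓ
      exact ⟨ℓ, hℓ.1, hτ' ℓ hℓ.2 h⟩
  · rintro ⟨C, hC, hsub, hunsat⟩
    refine ⟨C, hC, fun τ hτ => ?_, fun τ hτ D hD => ?_⟩
    · by_contra hτC
      refine hunsat ⟨τ, fun E hE => ?_⟩
      obtain ⟨D, hD, rfl⟩ := Finset.mem_image.1 hE
      obtain ⟨ℓ, hℓ, h⟩ := hτ D hD
      refine ⟨ℓ, Finset.mem_sdiff.2 ⟨hℓ, fun hℓC => hτC ?_⟩, h⟩
      simpa [SatCNF] using ⟨ℓ, hℓC, h⟩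
    · obtain ⟨ℓ, hℓ, h⟩ := hτ C (Finset.mem_singleton_self C)
      exact ⟨ℓ, hsub D hD hℓ, h⟩
end

section
/- If G is a hitting CNF formula, F ⊆ G is a factor of G with basis C, and D ∈ G \ F does not clash with C, then ¬D (the assignment setting every literal of D to 0, extended arbitrarily) satisfies F[¬C]; hence, if F is a factor, C clashes with every clause of G \ F. -/
/-- `D` is the resolvent of `C₁` and `C₂` (on the unique clashing literal `ℓ`). -/
def Resolvent (C₁ C₂ D : Clause) : Prop :=
  ∃ ℓ : Lit, C₁ ∩ C₂.image Lit.neg = {ℓ} ∧ D = (C₁ ∪ C₂) \ {ℓ, Lit.neg ℓ}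

/-- `L` is a resolution refutation of `F`: every clause of the sequence is an axiom
(clause of `F`) or a resolvent of two earlier clauses, and the last clause is empty. -/
def IsRefutation (F : CNF) (L : List Clause) : Prop :=
  L ≠ [] ∧ L.getLast? = some (∅ : Clause) ∧
    ∀ i < L.length, L.getD i ∅ ∈ F ∨
      ∃ j k, j < i ∧ k < i ∧ Resolvent (L.getD j ∅) (L.getD k ∅) (L.getD i ∅)

/-- Resolution hardness: the minimum length of a resolution refutation. -/
noncomputable def hardness (F : CNF) : ℕ :=
  sInf {n | ∃ L : List Clause, IsRefutation F L ∧ L.length = n}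

/-- The restriction `F[¬C]`: the result of setting all literals of `C` to 0 in `F`. -/
def restrictByNegC (F : CNF) (C : Clause) : CNF :=
  (F.filter fun D => ∀ ℓ ∈ C, Lit.neg ℓ ∉ D).image fun D => D \ C

/-- `C` is a clause interpolant of `(F, H)`: `F ⊨ C` and `{C} ∪ H` is unsatisfiable. -/
def ClauseInterpolant (C : Clause) (F H : CNF) : Prop :=
  C.NonTaut ∧ Entails F {C} ∧ Unsat (insert C H)

/-- `F` is a factor of `G`: a subset of `G` logically equivalent to a single clause. -/
def IsFactor (F G : CNF) : Prop :=
  F ⊆ G ∧ ∃ C : Clause, C.NonTaut ∧ Equivalent F {C}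

/-- `F` is a pseudo-factor of `G`: `(F, G \ F)` has a clause interpolant. -/
def IsPseudoFactor (F G : CNF) : Prop :=
  F ⊆ G ∧ ∃ C : Clause, ClauseInterpolant C F (G \ F)

/-- `G` is irreducible: every factor has size 1 or `|G|`. -/
def CNF.Irreducible (G : CNF) : Prop :=
  ∀ F : CNF, IsFactor F G → F.card = 1 ∨ F.card = G.card

/-- `G` is strongly irreducible: every pseudo-factor has size 1 or `|G|`. -/
def StronglyIrreducible (G : CNF) : Prop :=
  ∀ F : CNF, IsPseudoFactor F G → F.card = 1 ∨ F.card = G.card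

/-- `F` is minimally unsatisfiable: unsatisfiable, but every proper subset is satisfiable. -/
def MinimallyUnsat (F : CNF) : Prop :=
  Unsat F ∧ ∀ G : CNF, G ⊂ F → ∃ τ : ℕ → Bool, SatCNF τ G

theorem Lit.neg_neg (ℓ : Lit) : Lit.neg (Lit.neg ℓ) = ℓ := by
  simp [Lit.neg]

/-- Two non-clashing, non-tautological clauses can be falsified simultaneously. -/
theorem exists_falsifying_of_not_clash {C D : Clause} (hC : C.NonTaut) (hD : D.NonTaut)
    (hCD : ¬ Clash C D) :
    ∃ τ : ℕ → Bool, ∀ ℓ ∈ C ∪ D, SatLit τ (Lit.neg ℓ) := by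
  have key : ∀ ℓ ∈ C ∪ D, Lit.neg ℓ ∉ C ∪ D := by
    intro ℓ hℓ hn
    rw [Finset.mem_union] at hℓ hn
    rcases hℓ with h | h <;> rcases hn with h' | h'
    · exact hC ℓ h h'
    · exact hCD ⟨ℓ, h, h'⟩
    · exact hCD ⟨Lit.neg ℓ, h', (Lit.neg_neg ℓ).symm ▸ h⟩
    · exact hD ℓ h h'
  refine ⟨fun v => decide ((v, false) ∈ C ∪ D), ?_⟩
  rintro ⟨v, b⟩ h
  have hk := key _ h
  cases b
  · exact decide_eq_true h
  · exact decide_eq_false hk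

/-- A clash between `E` and a falsified clause `D` yields a satisfied literal of `E`. -/
theorem Clash.exists_satLit {E D : Clause} (h : Clash E D) {τ : ℕ → Bool}
    (hτ : ∀ ℓ ∈ D, SatLit τ (Lit.neg ℓ)) :
    ∃ ℓ ∈ E, Lit.neg ℓ ∈ D ∧ SatLit τ ℓ := by
  obtain ⟨ℓ, hE, hD⟩ := h
  exact ⟨ℓ, hE, hD, by simpa only [Lit.neg_neg] using hτ _ hD⟩

/-- if `G` is hitting, `F ⊆ G` is a factor of `G` with basis `C`, and
`D ∈ G \ F` does not clash with `C`, then any assignment setting every literal of `D`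
to 0 (extended arbitrarily) satisfies `F[¬C]`; hence `C` clashes with every clause of
`G \ F`. -/
theorem factor_basis_clashes (G F : CNF) (C : Clause)
    (hwf : G.WellFormed) (hhit : Hitting G) (hFG : F ⊆ G)
    (hC : C.NonTaut) (hbasis : Equivalent F {C}) :
    (∀ D ∈ G \ F, ¬ Clash C D →
      ∀ τ : ℕ → Bool, (∀ ℓ ∈ D, SatLit τ (Lit.neg ℓ)) →
        SatCNF τ (restrictByNegC F C)) ∧
      (∀ D ∈ G \ F, Clash C D) := by
  have hclash : ∀ D ∈ G \ F, ∀ E ∈ F, Clash E D := by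
    intro D hD E hE
    rw [Finset.mem_sdiff] at hD
    exact hhit E (hFG hE) D hD.1 fun h => hD.2 (h ▸ hE)
  refine ⟨?_, ?_⟩
  · intro D hD hCD τ hτ E' hE'
    obtain ⟨E, hE, rfl⟩ := Finset.mem_image.1 hE'
    obtain ⟨ℓ, hℓE, hℓD, hsat⟩ :=
      (hclash D hD E (Finset.mem_filter.1 hE).1).exists_satLit hτ
    exact ⟨ℓ, Finset.mem_sdiff.2 ⟨hℓE, fun hℓC => hCD ⟨ℓ, hℓC, hℓD⟩⟩, hsat⟩
  · intro D hD
    by_contra hCD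
    obtain ⟨τ, hτ⟩ :=
      exists_falsifying_of_not_clash hC (hwf D (Finset.mem_sdiff.1 hD).1) hCD
    have hF : SatCNF τ F := fun E hE => by
      obtain ⟨ℓ, hℓE, -, hsat⟩ := (hclash D hD E hE).exists_satLit
        fun ℓ hℓ => hτ ℓ (Finset.mem_union_right C hℓ)
      exact ⟨ℓ, hℓE, hsat⟩
    obtain ⟨ℓ, hℓC, hsat⟩ := hbasis.1 τ hF C (Finset.mem_singleton_self C)
    have hneg : τ ℓ.1 = !ℓ.2 := hτ ℓ (Finset.mem_union_left D hℓC)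
    have hpos : τ ℓ.1 = ℓ.2 := hsat
    simp [hpos] at hneg
end

section
/- In a minimally unsatisfiable CNF formula G, every factor F ⊆ G with |F| > 1 is intersection-maximal: every F' with F ⊊ F' ⊆ G satisfies ⋂F' ⊊ ⋂F (the common intersection strictly decreases). -/
/-- If every model of a clause `C` satisfies the non-tautological clause `D`, then `C ⊆ D`. -/
theorem Clause.NonTaut.subset_of_forall_satClause {C D : Clause} (hD : D.NonTaut)
    (h : ∀ τ : ℕ → Bool, SatClause τ C → SatClause τ D) : C ⊆ D := by
  intro ℓ hC
  by_contra hn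
  obtain ⟨⟨v, b⟩, hm, hsat⟩ :=
    h (fun v => if v = ℓ.1 then ℓ.2 else decide ((v, false) ∈ D)) ⟨ℓ, hC, by simp [SatLit]⟩
  simp only [SatLit] at hsat
  split_ifs at hsat with hv
  · subst hv hsat
    exact hn hm
  · have hneg := hD _ hm
    cases b <;> simp_all [Lit.neg]

/-- A clause implying every clause of a well-formed formula is contained in each of them. -/
theorem CNF.WellFormed.subset_of_entails {F : CNF} {C : Clause} (hF : F.WellFormed)
    (h : Entails {C} F) {D : Clause} (hD : D ∈ F) : C ⊆ D :=
  (hF D hD).subset_of_forall_satClause fun τ hτ => h τ (by simpa [SatCNF] using hτ) D hD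

/-- In a minimally unsatisfiable formula, no clause is entailed by a set of other clauses. -/
theorem MinimallyUnsat.not_entails_singleton {F G : CNF} {D : Clause} (hG : MinimallyUnsat G)
    (hFG : F ⊆ G) (hDG : D ∈ G) (hDF : D ∉ F) : ¬ Entails F {D} := by
  intro h
  obtain ⟨τ, hτ⟩ := hG.2 _ (Finset.erase_ssubset hDG)
  refine hG.1 ⟨τ, fun E hE => ?_⟩
  by_cases hED : E = D
  · exact h τ (fun B hB => hτ B (Finset.mem_erase.2 ⟨fun e => hDF (e ▸ hB), hFG hB⟩)) E
      (by simp [hED])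
  · exact hτ E (Finset.mem_erase.2 ⟨hED, hE⟩)

/-- in a minimally unsatisfiable formula `G`, every factor `F ⊆ G` with
`|F| > 1` is intersection-maximal: for every `F'` with `F ⊊ F' ⊆ G`, the common
intersection `⋂ F'` is a strict subset of `⋂ F`. -/
theorem factor_intersection_maximal (G F : CNF) (hwf : G.WellFormed)
    (hmu : MinimallyUnsat G) (hfac : IsFactor F G) (hcard : 1 < F.card) :
    ∀ F' : CNF, F ⊂ F' → F' ⊆ G →
      (⋂ D ∈ F', (D : Set Lit)) ⊂ ⋂ D ∈ F, (D : Set Lit) := by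
  intro F' hF hF'
  refine ⟨Set.biInter_subset_biInter_left hF.1, fun hsub => ?_⟩
  obtain ⟨hFG, C, -, hFC, hCF⟩ := hfac
  obtain ⟨D, hDF', hDF⟩ := Finset.exists_of_ssubset hF
  have hCD : C ⊆ D := fun ℓ hℓ => by
    have hmem : ℓ ∈ ⋂ E ∈ F, (E : Set Lit) := Set.mem_iInter₂.2 fun E hE =>
      CNF.WellFormed.subset_of_entails (fun B hB => hwf B (hFG hB)) hCF hE hℓ
    exact Set.mem_iInter₂.1 (hsub hmem) D hDF'
  refine hmu.not_entails_singleton hFG (hF' hDF') hDF fun τ hτ E hE => ?_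
  obtain ⟨ℓ, hℓ, hsat⟩ := hFC τ hτ C (Finset.mem_singleton_self C)
  exact ⟨ℓ, Finset.mem_singleton.1 hE ▸ hCD hℓ, hsat⟩
end
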